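/- In the bivariate case d = 2, the Sibuya copula under assumption (A) is a Marshall–Olkin copula: for all u_1, u_2 ∈ (0,1], C(u_1, u_2) = min{u_1^{−λ/λ_1}, u_2^{−λ/λ_2}}^{(1−e^{−H})^2} · u_1 u_2 = min{u_1^{1−θ_1} u_2, u_1 u_2^{1−θ_2}}, where θ_i := (1 − e^{−H})^2 λ/λ_i ∈ [0,1] for i = 1, 2. -/

import Mathlib

/-- In the bivariate case, the Sibuya copula under assumption (A) is a
Marshall–Olkin copula: for `u_1, u_2 ∈ (0,1]`,
`C(u_1, u_2) = min{u_1^{−λ/λ_1}, u_2^{−λ/λ_2}}^{(1−e^{−H})^2} · u_1 u_2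
  = min{u_1^{1−θ_1} u_2, u_1 u_2^{1−θ_2}}`,
where `λ_i = μ_i + λ(1 − e^{−H})` and `θ_i = (1 − e^{−H})^2 λ/λ_i ∈ [0,1]` for `i = 1, 2`. -/
theorem sibuyaA_bivariate_marshall_olkin
    (H lam : ℝ) (hH : 0 < H) (hlam : 0 < lam)
    (μ₁ μ₂ : ℝ) (hμ₁ : 0 ≤ μ₁) (hμ₂ : 0 ≤ μ₂)
    (u₁ u₂ : ℝ) (hu₁ : 0 < u₁ ∧ u₁ ≤ 1) (hu₂ : 0 < u₂ ∧ u₂ ≤ 1) :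
    (0 ≤ (1 - Real.exp (-H)) ^ 2 * lam / (μ₁ + lam * (1 - Real.exp (-H)))
      ∧ (1 - Real.exp (-H)) ^ 2 * lam / (μ₁ + lam * (1 - Real.exp (-H))) ≤ 1)
    ∧ (0 ≤ (1 - Real.exp (-H)) ^ 2 * lam / (μ₂ + lam * (1 - Real.exp (-H)))
      ∧ (1 - Real.exp (-H)) ^ 2 * lam / (μ₂ + lam * (1 - Real.exp (-H))) ≤ 1)
    ∧ min (u₁ ^ (-lam / (μ₁ + lam * (1 - Real.exp (-H)))))
          (u₂ ^ (-lam / (μ₂ + lam * (1 - Real.exp (-H)))))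
        ^ ((1 - Real.exp (-H)) ^ 2) * (u₁ * u₂)
      = min (u₁ ^ (1 - (1 - Real.exp (-H)) ^ 2 * lam / (μ₁ + lam * (1 - Real.exp (-H)))) * u₂)
            (u₁ * u₂ ^ (1 - (1 - Real.exp (-H)) ^ 2 * lam / (μ₂ + lam * (1 - Real.exp (-H))))) := by
  have hp0 : 0 < 1 - Real.exp (-H) := by
    have : Real.exp (-H) < 1 := Real.exp_lt_one_iff.mpr (by linarith)
    linarith
  have hp1 : 1 - Real.exp (-H) ≤ 1 := by
    have := Real.exp_pos (-H)
    linarith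
  generalize 1 - Real.exp (-H) = p at hp0 hp1 ⊢
  have hd : ∀ m : ℝ, 0 ≤ m → 0 < m + lam * p := fun m hm => by positivity
  have key : ∀ m : ℝ, 0 ≤ m → 0 ≤ p ^ 2 * lam / (m + lam * p)
      ∧ p ^ 2 * lam / (m + lam * p) ≤ 1 := by
    intro m hm
    have h := hd m hm
    refine ⟨by positivity, ?_⟩
    rw [div_le_one h]
    have h2 : p * (lam * p) ≤ 1 * (lam * p) :=
      mul_le_mul_of_nonneg_right hp1 (by positivity)
    nlinarith
  have pw : ∀ u m : ℝ, 0 < u → (u ^ (-lam / (m + lam * p))) ^ (p ^ 2) * u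
      = u ^ (1 - p ^ 2 * lam / (m + lam * p)) := by
    intro u m hu
    rw [← Real.rpow_mul hu.le, ← Real.rpow_add_one hu.ne']
    congr 1
    ring
  refine ⟨key μ₁ hμ₁, key μ₂ hμ₂, ?_⟩
  obtain ⟨h1, -⟩ := hu₁
  obtain ⟨h2, -⟩ := hu₂
  rw [← pw u₁ μ₁ h1, ← pw u₂ μ₂ h2]
  have ha : 0 < u₁ ^ (-lam / (μ₁ + lam * p)) := Real.rpow_pos_of_pos h1 _
  have hb : 0 < u₂ ^ (-lam / (μ₂ + lam * p)) := Real.rpow_pos_of_pos h2 _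
  generalize u₁ ^ (-lam / (μ₁ + lam * p)) = a at ha ⊢
  generalize u₂ ^ (-lam / (μ₂ + lam * p)) = b at hb ⊢
  have hu : 0 < u₁ * u₂ := mul_pos h1 h2
  have e1 : a ^ (p ^ 2) * u₁ * u₂ = a ^ (p ^ 2) * (u₁ * u₂) := by ring
  have e2 : u₁ * (b ^ (p ^ 2) * u₂) = b ^ (p ^ 2) * (u₁ * u₂) := by ring
  rw [e1, e2]
  rcases le_total a b with h | h
  · rw [min_eq_left h, min_eq_left]
    exact mul_le_mul_of_nonneg_right (Real.rpow_le_rpow ha.le h (by positivity)) hu.le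
  · rw [min_eq_right h, min_eq_right]
    exact mul_le_mul_of_nonneg_right (Real.rpow_le_rpow hb.le h (by positivity)) hu.le
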